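/- Let (X,d,W) be a uniformly convex hyperbolic space with a monotone modulus of uniform convexity η, C a nonempty convex subset, T : C → C asymptotically nonexpansive with sequence (k_n), K ≥ 0 with Σ_{n=0}^∞ k_n ≤ K, and L ∈ ℕ, L ≥ 2, with 1/L ≤ λ_n ≤ 1 − 1/L for all n. Let x ∈ C and b > 0 be such that for every δ > 0 there exists p ∈ C with d(x,p) ≤ b and d(Tp,p) ≤ δ. Then lim_{n→∞} d(x_n, T x_n) = 0, and moreover for every ε ∈ (0,1] there exists N ≤ 2M with d(x_N, T x_N) ≤ ε, where M := ⌈3(5KD + D + 11/2)/θ⌉, D := e^K·(b + 2), θ := (ε/(L²·f(K)))·η((1+K)D + 1, ε/(f(K)·((1+K)D + 1))), and f(K) := 2(1 + (1+K)²(2+K)). -/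

import Mathlib

open Filter Set

section Hyperbolic

variable {X : Type*}

/-- A hyperbolic space structure: `W x y t` represents `(1-t)x ⊕ t y`. -/
structure IsWMap [MetricSpace X] (W : X → X → ℝ → X) : Prop where
  w1 : ∀ (x y z : X), ∀ t ∈ Set.Icc (0:ℝ) 1,
    dist z (W x y t) ≤ (1 - t) * dist z x + t * dist z y
  w2 : ∀ (x y : X), ∀ t ∈ Set.Icc (0:ℝ) 1, ∀ s ∈ Set.Icc (0:ℝ) 1,
    dist (W x y t) (W x y s) = |t - s| * dist x y
  w3 : ∀ (x y : X), ∀ t ∈ Set.Icc (0:ℝ) 1, W x y t = W y x (1 - t)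
  w4 : ∀ (x y z w : X), ∀ t ∈ Set.Icc (0:ℝ) 1,
    dist (W x z t) (W y w t) ≤ (1 - t) * dist x y + t * dist z w

/-- `η` is a modulus of uniform convexity for the hyperbolic space `(X, dist, W)`. -/
def IsUCModulus [MetricSpace X] (W : X → X → ℝ → X) (η : ℝ → ℝ → ℝ) : Prop :=
  (∀ r ε : ℝ, 0 < r → ε ∈ Set.Ioc (0:ℝ) 2 → η r ε ∈ Set.Ioc (0:ℝ) 1) ∧
  (∀ r ε : ℝ, ∀ a x y : X, 0 < r → ε ∈ Set.Ioc (0:ℝ) 2 →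
    dist x a ≤ r → dist y a ≤ r → ε * r ≤ dist x y →
    dist (W x y (1/2)) a ≤ (1 - η r ε) * r)

/-- The modulus `η` is monotone: nonincreasing in `r` for each fixed `ε`. -/
def MonotoneUCModulus (η : ℝ → ℝ → ℝ) : Prop :=
  ∀ ε ∈ Set.Ioc (0:ℝ) 2, ∀ r s : ℝ, 0 < r → r ≤ s → η s ε ≤ η r ε

/-- `C` is a convex subset w.r.t. the convexity map `W`. -/
def WConvex [MetricSpace X] (W : X → X → ℝ → X) (C : Set X) : Prop :=
  ∀ x ∈ C, ∀ y ∈ C, ∀ t ∈ Set.Icc (0:ℝ) 1, W x y t ∈ C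

/-- `T : C → C` is asymptotically nonexpansive with sequence `k`. -/
def AsymptoticallyNonexpansive [MetricSpace X] (C : Set X) (T : X → X) (k : ℕ → ℝ) : Prop :=
  Set.MapsTo T C C ∧ (∀ n, 0 ≤ k n) ∧
  Filter.Tendsto k Filter.atTop (nhds 0) ∧
  ∀ n : ℕ, ∀ x ∈ C, ∀ y ∈ C, dist (T^[n] x) (T^[n] y) ≤ (1 + k n) * dist x y

/-- `xseq` is the Krasnoselski–Mann iteration of `T` starting from `x`:
`x₀ = x`, `x_{n+1} = (1-λ_n) x_n ⊕ λ_n T^n x_n`. -/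
def IsKMIteration [MetricSpace X] (W : X → X → ℝ → X) (T : X → X) (lam : ℕ → ℝ)
    (x : X) (xseq : ℕ → X) : Prop :=
  xseq 0 = x ∧ ∀ n, xseq (n + 1) = W (xseq n) (T^[n] (xseq n)) (lam n)

end Hyperbolic

/-- In a uniformly convex hyperbolic space the points of a geodesic segment are determined by
(upper bounds on) their distances to the endpoints. -/
theorem IsUCModulus.segment_point_unique {X : Type*} [MetricSpace X] {W : X → X → ℝ → X}
    {η : ℝ → ℝ → ℝ} (hW : IsWMap W) (hUC : IsUCModulus W η) {x y z z' : X} {t : ℝ}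
    (hx : dist z x ≤ t * dist x y) (hx' : dist z' x ≤ t * dist x y)
    (hy : dist z y ≤ (1 - t) * dist x y) (hy' : dist z' y ≤ (1 - t) * dist x y) : z = z' := by
  by_contra hne
  have hd : 0 < dist z z' := dist_pos.2 hne
  have htri : dist z z' ≤ dist z x + dist z' x := dist_triangle_right z z' x
  set r := t * dist x y with hr
  have hr0 : 0 < r := by linarith
  have he : dist z z' / r ∈ Set.Ioc (0 : ℝ) 2 :=
    ⟨by positivity, by rw [div_le_iff₀ hr0]; linarith⟩
  have hmid := hUC.2 r _ x z z' hr0 he hx hx' (div_mul_cancel₀ _ hr0.ne').le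
  have hη := (hUC.1 r _ hr0 he).1
  have hmid' := hW.w1 z z' y (1 / 2) ⟨by norm_num, by norm_num⟩
  have hxy := dist_triangle_left x y (W z z' (1 / 2))
  rw [dist_comm y, dist_comm y, dist_comm y] at hmid'
  nlinarith [mul_pos hη hr0]

/-- A point `W x y t` with `t ≤ 1/2` lies on the segment from `x` to the midpoint. -/
theorem IsUCModulus.eq_segment_midpoint {X : Type*} [MetricSpace X] {W : X → X → ℝ → X}
    {η : ℝ → ℝ → ℝ} (hW : IsWMap W) (hUC : IsUCModulus W η) (x y : X) {t : ℝ} (ht : 0 ≤ t)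
    (ht' : t ≤ 1 / 2) : W x y t = W x (W x y (1 / 2)) (2 * t) := by
  have hhalf : (1 / 2 : ℝ) ∈ Set.Icc (0 : ℝ) 1 := ⟨by norm_num, by norm_num⟩
  have hmem : t ∈ Set.Icc (0 : ℝ) 1 := ⟨ht, by linarith⟩
  have hmem2 : 2 * t ∈ Set.Icc (0 : ℝ) 1 := ⟨by linarith, by linarith⟩
  have h1 := hW.w1 x y x t hmem
  have h2 := hW.w1 x y y t hmem
  have h3 := hW.w1 x y x (1 / 2) hhalf
  have h4 := hW.w1 x y y (1 / 2) hhalf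
  have h5 := hW.w1 x (W x y (1 / 2)) x (2 * t) hmem2
  have h6 := hW.w1 x (W x y (1 / 2)) y (2 * t) hmem2
  simp only [dist_self, dist_comm y x] at h1 h2 h3 h4 h5 h6
  apply hUC.segment_point_unique hW (x := x) (y := y) (t := t)
  · rw [dist_comm]; linarith
  · rw [dist_comm]; nlinarith
  · rw [dist_comm]; linarith
  · rw [dist_comm]; nlinarith

/-- Uniform convexity at points `W x y t` with `t` bounded away from `0` and `1`. -/
theorem IsUCModulus.dist_le {X : Type*} [MetricSpace X] {W : X → X → ℝ → X}
    {η : ℝ → ℝ → ℝ} (hW : IsWMap W) (hUC : IsUCModulus W η) {x y a : X} {r ε c t : ℝ}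
    (hr : 0 < r) (hε : ε ∈ Set.Ioc (0 : ℝ) 2) (hxa : dist x a ≤ r) (hya : dist y a ≤ r)
    (hxy : ε * r ≤ dist x y) (hc : 0 ≤ c) (hct : c ≤ t) (htc : t ≤ 1 - c) :
    dist (W x y t) a ≤ (1 - 2 * c * η r ε) * r := by
  have hη := (hUC.1 r ε hr hε).1
  wlog ht : t ≤ 1 / 2 generalizing x y t
  · rw [hW.w3 x y t ⟨by linarith, by linarith⟩]
    exact this hya hxa (by rwa [dist_comm]) (by linarith) (by linarith) (by linarith)
  have hmid := hUC.2 r ε a x y hr hε hxa hya hxy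
  rw [hUC.eq_segment_midpoint hW x y (hc.trans hct) ht]
  have h := hW.w1 x (W x y (1 / 2)) a (2 * t) ⟨by linarith, by linarith⟩
  rw [dist_comm a, dist_comm a, dist_comm a] at h
  have h1 : (1 - 2 * t) * dist x a ≤ (1 - 2 * t) * r :=
    mul_le_mul_of_nonneg_left hxa (by linarith)
  have h2 : 2 * t * dist (W x y (1 / 2)) a ≤ 2 * t * ((1 - η r ε) * r) :=
    mul_le_mul_of_nonneg_left hmid (by linarith)
  nlinarith [mul_le_mul_of_nonneg_right hct (mul_pos hη hr).le]

theorem AsymptoticallyNonexpansive.le_of_sum_le {X : Type*} [MetricSpace X] {C : Set X}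
    {T : X → X} {k : ℕ → ℝ} (hT : AsymptoticallyNonexpansive C T k) {K : ℝ}
    (hsum : ∀ n : ℕ, ∑ i ∈ Finset.range n, k i ≤ K) (n : ℕ) : k n ≤ K :=
  (Finset.single_le_sum (fun i _ => hT.2.1 i) (Finset.self_mem_range_succ n)).trans (hsum (n + 1))

theorem AsymptoticallyNonexpansive.dist_iterate_le {X : Type*} [MetricSpace X] {C : Set X}
    {T : X → X} {k : ℕ → ℝ} (hT : AsymptoticallyNonexpansive C T k) {K : ℝ}
    (hk : ∀ n, k n ≤ K) {p : X} (hp : p ∈ C) (n : ℕ) :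
    dist (T^[n] p) p ≤ n * ((1 + K) * dist (T p) p) := by
  induction n with
  | zero => simp
  | succ n ih =>
    have h := hT.2.2.2 n (T p) (hT.1 hp) p hp
    have h' : (1 + k n) * dist (T p) p ≤ (1 + K) * dist (T p) p :=
      mul_le_mul_of_nonneg_right (by linarith [hk n]) dist_nonneg
    have := dist_triangle (T^[n] (T p)) (T^[n] p) p
    rw [Function.iterate_succ_apply]
    push_cast
    linarith

theorem IsKMIteration.mem {X : Type*} [MetricSpace X] {W : X → X → ℝ → X} {C : Set X}
    {T : X → X} {lam : ℕ → ℝ} {x : X} {xseq : ℕ → X} (hKM : IsKMIteration W T lam x xseq)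
    (hconv : WConvex W C) (hT : Set.MapsTo T C C) (hlam : ∀ n, lam n ∈ Set.Icc (0 : ℝ) 1)
    (hx : x ∈ C) (n : ℕ) : xseq n ∈ C := by
  induction n with
  | zero => rwa [hKM.1]
  | succ n ih => rw [hKM.2]; exact hconv _ ih _ (hT.iterate n ih) _ (hlam n)

/-- If two consecutive iterates are almost fixed by the corresponding powers of `T`, then the
second one is almost fixed by `T`. -/
theorem IsKMIteration.dist_succ_le {X : Type*} [MetricSpace X] {W : X → X → ℝ → X} {C : Set X}
    {T : X → X} {k lam : ℕ → ℝ} {x : X} {xseq : ℕ → X} (hKM : IsKMIteration W T lam x xseq)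
    (hW : IsWMap W) (hT : AsymptoticallyNonexpansive C T k) {K e : ℝ} (hk : ∀ n, k n ≤ K)
    (hlam : ∀ n, lam n ∈ Set.Icc (0 : ℝ) 1) (hmem : ∀ n, xseq n ∈ C) {n : ℕ}
    (h : dist (xseq n) (T^[n] (xseq n)) ≤ e)
    (h' : dist (xseq (n + 1)) (T^[n + 1] (xseq (n + 1))) ≤ e) :
    dist (xseq (n + 1)) (T (xseq (n + 1))) ≤ e * (2 * (1 + (1 + K) ^ 2 * (2 + K))) := by
  have hK : 0 ≤ K := (hT.2.1 0).trans (hk 0)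
  have he : 0 ≤ e := dist_nonneg.trans h
  have hstep : dist (xseq n) (xseq (n + 1)) ≤ e := by
    have h1 := hW.w1 (xseq n) (T^[n] (xseq n)) (xseq n) (lam n) (hlam n)
    rw [← hKM.2, dist_self] at h1
    nlinarith [mul_le_mul (hlam n).2 h dist_nonneg zero_le_one]
  have lip : ∀ m, ∀ u ∈ C, ∀ v ∈ C, dist (T^[m] u) (T^[m] v) ≤ (1 + K) * dist u v :=
    fun m u hu v hv => (hT.2.2.2 m u hu v hv).trans
      (mul_le_mul_of_nonneg_right (by linarith [hk m]) dist_nonneg)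
  set y := xseq (n + 1) with hy
  have hyC : y ∈ C := hmem (n + 1)
  have h1 := lip 1 (T^[n] y) (hT.1.iterate n hyC) y hyC
  rw [Function.iterate_one, ← Function.iterate_succ_apply' T n y] at h1
  have h2 := lip n y hyC (xseq n) (hmem n)
  have h3 : dist (T^[n] y) y ≤ (1 + K) * e + e + e := by
    have := dist_triangle4 (T^[n] y) (T^[n] (xseq n)) (xseq n) y
    have h4 : (1 + K) * dist y (xseq n) ≤ (1 + K) * e :=
      mul_le_mul_of_nonneg_left (by rwa [dist_comm]) (by linarith)
    rw [dist_comm (T^[n] (xseq n)) (xseq n)] at this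
    linarith
  have h5 := mul_le_mul_of_nonneg_left h3 (by linarith : (0 : ℝ) ≤ 1 + K)
  have h6 := dist_triangle y (T^[n + 1] y) (T y)
  calc dist y (T y) ≤ e * (1 + (1 + K) * (3 + K)) := by linarith
    _ ≤ e * (2 * (1 + (1 + K) ^ 2 * (2 + K))) := by
      apply mul_le_mul_of_nonneg_left _ he
      nlinarith [mul_nonneg hK hK, mul_nonneg (mul_nonneg hK hK) hK]

open Classical in
/-- The number of indices at which `xseq i` is moved by more than `e` by `T^[i]` is bounded
uniformly in the horizon `n`. -/
theorem IsKMIteration.card_far_mul_le {X : Type*} [MetricSpace X] {W : X → X → ℝ → X}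
    {η : ℝ → ℝ → ℝ} (hW : IsWMap W) (hUC : IsUCModulus W η) (hMon : MonotoneUCModulus η)
    {C : Set X} {T : X → X} {k : ℕ → ℝ} (hT : AsymptoticallyNonexpansive C T k) {K : ℝ}
    (hsum : ∀ n : ℕ, ∑ i ∈ Finset.range n, k i ≤ K)
    {lam : ℕ → ℝ} {c : ℝ} (hc : 0 ≤ c) (hlam : ∀ n, c ≤ lam n ∧ lam n ≤ 1 - c) {x : X}
    {b : ℝ} (hb : 0 < b) (happ : ∀ δ > (0 : ℝ), ∃ p ∈ C, dist x p ≤ b ∧ dist (T p) p ≤ δ)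
    {xseq : ℕ → X} (hKM : IsKMIteration W T lam x xseq) (hmem : ∀ n, xseq n ∈ C)
    {D R e : ℝ} (hD : D = Real.exp K * (b + 2)) (hR : R = (1 + K) * D + 1)
    (he : 0 < e) (heR : e ≤ 1) (n : ℕ) :
    ({i ∈ Finset.range n | e < dist (xseq i) (T^[i] (xseq i))}.card : ℝ) *
      (c * e * η R (e / R)) ≤ K * D + D := by
  have hk := hT.le_of_sum_le hsum
  have hk0 := hT.2.1
  have hK : 0 ≤ K := (hk0 0).trans (hk 0)
  have hexp : 1 ≤ Real.exp K := Real.one_le_exp hK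
  have hDb : b + 2 ≤ D := by rw [hD]; nlinarith
  have hR1 : 1 ≤ R := by rw [hR]; nlinarith
  have hR0 : 0 < R := by linarith
  have heR2 : e / R ∈ Set.Ioc (0 : ℝ) 2 :=
    ⟨by positivity, by rw [div_le_iff₀ hR0]; linarith⟩
  have hη0 := (hUC.1 R _ hR0 heR2).1
  set θ := c * e * η R (e / R) with hθ
  obtain ⟨γ, hγ0, hγ⟩ : ∃ γ : ℝ, 0 < γ ∧ (n + 1) * γ = 1 :=
    ⟨1 / (n + 1), by positivity, by field_simp⟩
  obtain ⟨p, hp, hxp, hTp⟩ := happ (γ * γ / (1 + K)) (by positivity)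
  have hiter : ∀ i, i ≤ n → dist (T^[i] p) p ≤ γ := by
    intro i hi
    have hi' : (i : ℝ) ≤ n := by exact_mod_cast hi
    have h := hT.dist_iterate_le hk hp i
    have h1 : (1 + K) * dist (T p) p ≤ γ * γ := by
      rwa [le_div_iff₀ (by linarith), mul_comm] at hTp
    have h2 : (i : ℝ) * ((1 + K) * dist (T p) p) ≤ (n + 1) * (γ * γ) :=
      mul_le_mul (by linarith) h1 (by positivity) (by positivity)
    rw [← mul_assoc (_ + 1 : ℝ), hγ, one_mul] at h2
    linarith
  have hTx : ∀ i, i ≤ n →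
      dist (T^[i] (xseq i)) p ≤ (1 + k i) * dist (xseq i) p + γ := fun i hi => by
    linarith [dist_triangle (T^[i] (xseq i)) (T^[i] p) p, hiter i hi,
      hT.2.2.2 i _ (hmem i) p hp]
  have hxr : ∀ i, dist (xseq i) p ≤ (1 + k i) * dist (xseq i) p + γ := fun i => by
    nlinarith [mul_nonneg (hk0 i) (dist_nonneg (x := xseq i) (y := p))]
  have hstep : ∀ i, i ≤ n →
      dist (xseq (i + 1)) p ≤ (1 + k i) * dist (xseq i) p + γ := by
    intro i hi
    have h0 : 0 ≤ lam i := hc.trans (hlam i).1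
    have h1 : 0 ≤ 1 - lam i := by linarith [(hlam i).2]
    have h := hW.w1 (xseq i) (T^[i] (xseq i)) p (lam i) ⟨h0, by linarith⟩
    rw [← hKM.2, dist_comm p, dist_comm p, dist_comm p] at h
    nlinarith [mul_le_mul_of_nonneg_left (hTx i hi) h0, mul_le_mul_of_nonneg_left (hxr i) h1]
  have hin : ∀ i, i ≤ n → (i : ℝ) * γ ≤ 1 := fun i hi => by
    have hi' : (i : ℝ) ≤ n := by exact_mod_cast hi
    nlinarith
  have hexpb : ∀ i, i ≤ n →
      dist (xseq i) p ≤ Real.exp (∑ j ∈ Finset.range i, k j) * (b + i * γ) := by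
    intro i hi
    induction i with
    | zero => simpa [hKM.1] using hxp
    | succ i ih =>
      have ih := ih (by omega)
      have hpos : 0 ≤ Real.exp (∑ j ∈ Finset.range i, k j) * (b + i * γ) := by positivity
      have h1 : (1 + k i) * dist (xseq i) p ≤
          Real.exp (k i) * (Real.exp (∑ j ∈ Finset.range i, k j) * (b + i * γ)) :=
        mul_le_mul (by linarith [Real.add_one_le_exp (k i)]) ih dist_nonneg (Real.exp_pos _).le
      have h2 : 1 ≤ Real.exp (∑ j ∈ Finset.range (i + 1), k j) :=
        Real.one_le_exp (Finset.sum_nonneg fun j _ => hk0 j)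
      have h3 := hstep i (by omega)
      rw [Finset.sum_range_succ, Real.exp_add] at h2 ⊢
      push_cast
      nlinarith [mul_le_mul_of_nonneg_right h2 hγ0.le]
  have hbound : ∀ i, i ≤ n → dist (xseq i) p ≤ D := by
    intro i hi
    refine (hexpb i hi).trans ?_
    rw [hD]
    exact mul_le_mul (Real.exp_le_exp.2 (hsum i)) (by linarith [hin i hi]) (by positivity)
      (Real.exp_pos _).le
  have hdec : ∀ i, i ≤ n → e < dist (xseq i) (T^[i] (xseq i)) →
      dist (xseq (i + 1)) p ≤ (1 + k i) * dist (xseq i) p + γ - θ := by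
    intro i hi hfar
    have hx1 := hxr i
    have hx2 := hTx i hi
    have hrR : (1 + k i) * dist (xseq i) p + γ ≤ R := by
      have h1 : (1 + k i) * dist (xseq i) p ≤ (1 + K) * D :=
        mul_le_mul (by linarith [hk i]) (hbound i hi) dist_nonneg (by linarith)
      have h2 : γ ≤ 1 := by nlinarith [Nat.cast_nonneg (α := ℝ) n]
      rw [hR]; linarith
    have htri := dist_triangle_right (xseq i) (T^[i] (xseq i)) p
    set r := (1 + k i) * dist (xseq i) p + γ with hr
    have her : e ≤ 2 * r := by linarith
    have hr0 : 0 < r := by linarith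
    have hsep : e / R * r ≤ dist (xseq i) (T^[i] (xseq i)) := by
      rw [div_mul_eq_mul_div]
      exact ((div_le_iff₀ hR0).2 (mul_le_mul_of_nonneg_left hrR he.le)).trans hfar.le
    have h := hUC.dist_le hW hr0 heR2 hx1 hx2 hsep hc (hlam i).1 (hlam i).2
    rw [← hKM.2] at h
    have hmono := hMon _ heR2 r R hr0 hrR
    have h1 : c * e * η R (e / R) ≤ c * (2 * r) * η r (e / R) :=
      mul_le_mul (mul_le_mul_of_nonneg_left her hc) hmono hη0.le (by positivity)
    rw [hθ]
    linarith
  have htel : ∀ i, i ≤ n → dist (xseq i) p +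
      ({j ∈ Finset.range i | e < dist (xseq j) (T^[j] (xseq j))}.card : ℝ) * θ ≤
        b + D * ∑ j ∈ Finset.range i, k j + i * γ := by
    intro i hi
    induction i with
    | zero => simpa [hKM.1] using hxp
    | succ i ih =>
      have ih := ih (by omega)
      have hkD := mul_le_mul_of_nonneg_left (hbound i (by omega)) (hk0 i)
      rw [Finset.sum_range_succ, Finset.range_add_one, Finset.filter_insert]
      split_ifs with hfar
      · rw [Finset.card_insert_of_notMem (by simp)]
        have := hdec i (by omega) hfar
        push_cast
        linarith
      · have := hstep i (by omega)
        push_cast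
        linarith
  have h := htel n le_rfl
  have h1 : D * ∑ j ∈ Finset.range n, k j ≤ D * K :=
    mul_le_mul_of_nonneg_left (hsum n) (by linarith)
  linarith [hin n le_rfl, dist_nonneg (x := xseq n) (y := p)]

/-- If `P` holds at one of `2i`, `2i+1` for every `i < M`, it holds at least `M` times below `2M`. -/
theorem le_card_filter_range_two_mul (P : ℕ → Prop) [DecidablePred P] {M : ℕ}
    (h : ∀ i < M, P (2 * i) ∨ P (2 * i + 1)) :
    M ≤ {j ∈ Finset.range (2 * M) | P j}.card := by
  induction M with
  | zero => simp
  | succ M ih =>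
    have ih := ih fun i hi => h i (by omega)
    rw [show 2 * (M + 1) = 2 * M + 1 + 1 by ring, Finset.range_add_one, Finset.range_add_one,
      Finset.filter_insert, Finset.filter_insert]
    have := h M (by omega)
    split_ifs <;> simp_all
    omega


/-- asymptotic regularity with an explicit rate `2M` (the case `g ≡ 0`). -/
theorem asymptotic_regularity_with_rate
    {X : Type*} [MetricSpace X]
    (W : X → X → ℝ → X) (η : ℝ → ℝ → ℝ)
    (hW : IsWMap W) (hUC : IsUCModulus W η) (hMon : MonotoneUCModulus η)
    (C : Set X) (hne : C.Nonempty) (hconv : WConvex W C)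
    (T : X → X) (k : ℕ → ℝ) (hT : AsymptoticallyNonexpansive C T k)
    (K : ℝ) (hK : 0 ≤ K) (hsum : ∀ n : ℕ, ∑ i ∈ Finset.range n, k i ≤ K)
    (L : ℕ) (hL : 2 ≤ L) (lam : ℕ → ℝ)
    (hlam : ∀ n, 1 / (L : ℝ) ≤ lam n ∧ lam n ≤ 1 - 1 / (L : ℝ))
    (x : X) (hx : x ∈ C) (b : ℝ) (hb : 0 < b)
    (happ : ∀ δ > (0:ℝ), ∃ p ∈ C, dist x p ≤ b ∧ dist (T p) p ≤ δ)
    (xseq : ℕ → X) (hKM : IsKMIteration W T lam x xseq) :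
    Filter.Tendsto (fun n => dist (xseq n) (T (xseq n))) Filter.atTop (nhds 0) ∧
    ∀ ε : ℝ, 0 < ε → ε ≤ 1 →
      ∀ (fK D θ : ℝ) (M : ℕ),
        fK = 2 * (1 + (1 + K) ^ 2 * (2 + K)) →
        D = Real.exp K * (b + 2) →
        θ = ε / ((L : ℝ) ^ 2 * fK) * η ((1 + K) * D + 1) (ε / (fK * ((1 + K) * D + 1))) →
        M = ⌈3 * (5 * K * D + D + 11 / 2) / θ⌉₊ →
        ∃ N ≤ 2 * M, dist (xseq N) (T (xseq N)) ≤ ε := by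
  classical
  have hL2 : (2 : ℝ) ≤ L := by exact_mod_cast hL
  have hL0 : (0 : ℝ) < L := by linarith
  have hc : 0 < 1 / (L : ℝ) := by positivity
  have hlam' : ∀ n, lam n ∈ Set.Icc (0 : ℝ) 1 := fun n =>
    ⟨by linarith [(hlam n).1], by linarith [(hlam n).2]⟩
  have hk := hT.le_of_sum_le hsum
  have hmem := hKM.mem hconv hT.1 hlam' hx
  have hDpos : 0 < Real.exp K * (b + 2) := by positivity
  have hRpos : 1 ≤ (1 + K) * (Real.exp K * (b + 2)) + 1 := by
    have : 0 ≤ (1 + K) * (Real.exp K * (b + 2)) := by positivity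
    linarith
  have hηpos : ∀ e : ℝ, 0 < e → e ≤ 1 → 0 < η ((1 + K) * (Real.exp K * (b + 2)) + 1)
      (e / ((1 + K) * (Real.exp K * (b + 2)) + 1)) := fun e he he1 =>
    (hUC.1 _ _ (by linarith) ⟨by positivity, by rw [div_le_iff₀ (by linarith)]; linarith⟩).1
  have hcard := fun (e : ℝ) (he : 0 < e) (he1 : e ≤ 1) =>
    hKM.card_far_mul_le hW hUC hMon hT hsum hc.le hlam hb happ hmem rfl rfl he he1
  have hfK : 6 ≤ 2 * (1 + (1 + K) ^ 2 * (2 + K)) := by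
    nlinarith [mul_nonneg hK hK, mul_nonneg (mul_nonneg hK hK) hK]
  refine ⟨?_, ?_⟩
  · have hfin : ∀ e : ℝ, 0 < e → e ≤ 1 →
        ∀ᶠ n in atTop, dist (xseq n) (T^[n] (xseq n)) ≤ e := by
      intro e he he1
      have hset : {i | e < dist (xseq i) (T^[i] (xseq i))}.Finite := by
        by_contra hinf
        have hθ := mul_pos (mul_pos hc he) (hηpos e he he1)
        set θ := 1 / (L : ℝ) * e * η ((1 + K) * (Real.exp K * (b + 2)) + 1)
          (e / ((1 + K) * (Real.exp K * (b + 2)) + 1))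
        obtain ⟨m, hm⟩ := exists_nat_gt
          ((K * (Real.exp K * (b + 2)) + Real.exp K * (b + 2)) / θ)
        obtain ⟨s, hs, hsc⟩ := Set.Infinite.exists_subset_card_eq hinf m
        have hsub : s ⊆ {i ∈ Finset.range (s.sup id + 1) |
            e < dist (xseq i) (T^[i] (xseq i))} := fun i hi =>
          Finset.mem_filter.2
            ⟨Finset.mem_range.2 (Nat.lt_succ_of_le (Finset.le_sup (f := id) hi)), hs hi⟩
        have h1 : (m : ℝ) ≤ ({i ∈ Finset.range (s.sup id + 1) |
            e < dist (xseq i) (T^[i] (xseq i))}.card : ℝ) := by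
          exact_mod_cast hsc ▸ Finset.card_le_card hsub
        rw [div_lt_iff₀ hθ] at hm
        linarith [mul_le_mul_of_nonneg_right h1 hθ.le, hcard e he he1 (s.sup id + 1)]
      have hev := hset.eventually_cofinite_notMem
      rw [Nat.cofinite_eq_atTop] at hev
      filter_upwards [hev] with n hn using not_lt.1 hn
    rw [Metric.tendsto_atTop]
    intro ε hε
    set e := min 1 (ε / 2 / (2 * (1 + (1 + K) ^ 2 * (2 + K)))) with he
    obtain ⟨N, hN⟩ := eventually_atTop.1
      (hfin e (lt_min one_pos (by positivity)) (min_le_left _ _))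
    refine ⟨N + 1, fun n hn => ?_⟩
    obtain ⟨m, rfl⟩ : ∃ m, n = m + 1 := ⟨n - 1, by omega⟩
    have h := hKM.dist_succ_le hW hT hk hlam' hmem (hN m (by omega)) (hN (m + 1) (by omega))
    have h' : e * (2 * (1 + (1 + K) ^ 2 * (2 + K))) ≤ ε / 2 :=
      (le_div_iff₀ (by linarith)).1 (min_le_right _ _)
    rw [Real.dist_0_eq_abs, abs_of_nonneg dist_nonneg]
    linarith
  · intro ε hε hε1 fK D θ M hfKeq hD hθ hM
    rw [← hfKeq] at hfK
    rw [← hD] at hDpos hRpos hηpos hcard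
    have hfK0 : 0 < fK := by linarith
    have he : 0 < ε / fK := by positivity
    have he1 : ε / fK ≤ 1 := by rw [div_le_one hfK0]; linarith
    have hη := hηpos _ he he1
    have hθ' : θ = ε / fK * η ((1 + K) * D + 1) (ε / fK / ((1 + K) * D + 1)) / (L : ℝ) ^ 2 := by
      rw [hθ, ← div_div ε fK]
      field_simp
    have hθ0 : 0 < θ := by rw [hθ']; positivity
    have hθle : θ ≤ 1 / (L : ℝ) * (ε / fK) *
        η ((1 + K) * D + 1) (ε / fK / ((1 + K) * D + 1)) := by
      rw [hθ', mul_assoc, one_div_mul_eq_div]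
      exact div_le_div_of_nonneg_left (by positivity) hL0 (by nlinarith)
    by_contra! hcon
    have hfar : ∀ i < M, ε / fK < dist (xseq (2 * i)) (T^[2 * i] (xseq (2 * i))) ∨
        ε / fK < dist (xseq (2 * i + 1)) (T^[2 * i + 1] (xseq (2 * i + 1))) := by
      intro i hi
      by_contra! hnear
      have h := hKM.dist_succ_le hW hT hk hlam' hmem hnear.1 hnear.2
      rw [← hfKeq, div_mul_cancel₀ _ hfK0.ne'] at h
      exact (hcon (2 * i + 1) (by omega)).not_ge h
    have hMcard : (M : ℝ) ≤ _ := Nat.cast_le.2 (le_card_filter_range_two_mul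
      (fun i => ε / fK < dist (xseq i) (T^[i] (xseq i))) hfar)
    have hMθ : 3 * (5 * K * D + D + 11 / 2) ≤ M * θ := by
      rw [← div_le_iff₀ hθ0, hM]
      exact Nat.le_ceil _
    have h1 := mul_le_mul hMcard hθle hθ0.le (Nat.cast_nonneg _)
    have h2 := hcard _ he he1 (2 * M)
    nlinarith [mul_nonneg hK hDpos.le]
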